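/- arXiv:2212.06650 — 2 statements merged into one kernel-verified Lean document; each statement's English description precedes it below -/
import Mathlib

section
/- Let m and t be positive integers with m/2 < t ≤ m. Then B_m(t) ⋆ {(3), (1,1,1)} = B_{m+3}(t+3) ∖ {(t+1, t+1), (2^{t+1})} if m = 2t − 1, and B_m(t) ⋆ {(3), (1,1,1)} = B_{m+3}(t+3) otherwise. In particular, P(m) ⋆ {(3), (1,1,1)} = P(m+3) for every m ≥ 2. -/
open scoped Classical

namespace SylowBranching

/-- The cells of the Young diagram of `f` (rows indexed by the first coordinate,
starting from `0`; `f i` is the length of row `i`). -/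
def cellsOf (f : ℕ → ℕ) : Set (ℕ × ℕ) := {p | p.2 < f p.1}

/-- `f : ℕ → ℕ` is a partition if it is weakly decreasing with finitely many
nonzero parts.  Its parts are `f 0 ≥ f 1 ≥ ⋯`, and its largest part is `f 0`. -/
def IsPartition (f : ℕ → ℕ) : Prop :=
  Antitone f ∧ ∃ N, ∀ i, N ≤ i → f i = 0

/-- The size `|f|` of a partition: the number of cells of its Young diagram. -/
noncomputable def psize (f : ℕ → ℕ) : ℕ := (cellsOf f).ncard

/-- `P(n)`: the set of partitions of `n`. -/
def Pset (n : ℕ) : Set (ℕ → ℕ) := {f | IsPartition f ∧ psize f = n}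

/-- The conjugate (transpose) partition `f'`. -/
noncomputable def conj (f : ℕ → ℕ) : ℕ → ℕ := fun j => Set.ncard {i | j < f i}

/-- `A° = A ∪ A'`: the closure of a set of partitions under conjugation. -/
noncomputable def conjClosure (A : Set (ℕ → ℕ)) : Set (ℕ → ℕ) := A ∪ conj '' A

/-- `B_n(t)`: partitions of `n` with largest part at most `t` and at most `t` parts. -/
noncomputable def Bset (n t : ℕ) : Set (ℕ → ℕ) :=
  {f ∈ Pset n | f 0 ≤ t ∧ conj f 0 ≤ t}

/-- The cells of the skew shape `l / m`. -/
def skewCells (l m : ℕ → ℕ) : Set (ℕ × ℕ) :=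
  {p | m p.1 ≤ p.2 ∧ p.2 < l p.1}

/-- `d` is read before (or at the same time as) `c` in the reading order of a
filling: right-to-left along rows, rows from top to bottom. -/
def readBefore (d c : ℕ × ℕ) : Prop :=
  d.1 < c.1 ∨ (d.1 = c.1 ∧ c.2 ≤ d.2)

/-- A Littlewood–Richardson filling of the cell set `γ` of weight `ν`:
all entries are positive; for every `j ≥ 1` there are exactly `ν (j-1)` entries
equal to `j` (i.e. the number of `j`s is the `j`-th part of `ν`); entries weakly
increase along rows and strictly increase down columns; and every initial
segment of the reading word (right-to-left along rows, top to bottom) contains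
at least as many entries equal to `j` as entries equal to `j+1`, for all `j ≥ 1`. -/
structure IsLRFilling (γ : Set (ℕ × ℕ)) (ν : ℕ → ℕ) (T : ℕ × ℕ → ℕ) : Prop where
  pos : ∀ c ∈ γ, 1 ≤ T c
  weight : ∀ j : ℕ, 1 ≤ j → Set.ncard {c ∈ γ | T c = j} = ν (j - 1)
  row_weak : ∀ i j j', (i, j) ∈ γ → (i, j') ∈ γ → j ≤ j' → T (i, j) ≤ T (i, j')
  col_strict : ∀ i i' j, (i, j) ∈ γ → (i', j) ∈ γ → i < i' → T (i, j) < T (i', j)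
  lattice : ∀ c ∈ γ, ∀ j : ℕ, 1 ≤ j →
    Set.ncard {d ∈ γ | T d = j + 1 ∧ readBefore d c} ≤
      Set.ncard {d ∈ γ | T d = j ∧ readBefore d c}

/-- `LR(γ)`: the set of all weights of LR fillings of `γ`. -/
def LRset (γ : Set (ℕ × ℕ)) : Set (ℕ → ℕ) := {ν | ∃ T, IsLRFilling γ ν T}

/-- The Littlewood–Richardson coefficient `c^l_{m ν}`: the number of LR fillings
of the skew shape `l / m` of weight `ν` (zero unless `m ⊆ l`); fillings are
normalised to vanish off the skew shape so that they can be counted. -/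
noncomputable def LRcoeff (l m ν : ℕ → ℕ) : ℕ :=
  Set.ncard {T : ℕ × ℕ → ℕ |
    (∀ i, m i ≤ l i) ∧ (∀ c, c ∉ skewCells l m → T c = 0) ∧
      IsLRFilling (skewCells l m) ν T}

/-- The `⋆` operation on sets of partitions:
`A ⋆ B = {λ : c^λ_{μν} > 0 for some μ ∈ A, ν ∈ B}`. -/
def starOp (A B : Set (ℕ → ℕ)) : Set (ℕ → ℕ) :=
  {l | IsPartition l ∧ ∃ μ ∈ A, ∃ ν ∈ B, 0 < LRcoeff l μ ν}

/-- The partition with the given (weakly decreasing) list of parts. -/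
def ofList (L : List ℕ) : ℕ → ℕ := fun i => L.getD i 0

/-- The hook partition `(a, 1^b)`. -/
def hookP (a b : ℕ) : ℕ → ℕ := ofList (a :: List.replicate b 1)

/-- The partition `(a, μ)` obtained by prepending a first part `a` to `μ`. -/
def consPart (a : ℕ) (μ : ℕ → ℕ) : ℕ → ℕ := fun i => if i = 0 then a else μ (i - 1)

/-- `γ` coincides, up to planar translation, with the Young diagram of `ν`. -/
def TranslateOf (γ : Set (ℕ × ℕ)) (ν : ℕ → ℕ) : Prop :=
  ∃ a b : ℕ, γ = (fun p : ℕ × ℕ => (p.1 + a, p.2 + b)) '' cellsOf ν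

/-- `γ` coincides, up to planar translation, with the 180°-rotation of the
Young diagram of `ν`. -/
def RotationOf (γ : Set (ℕ × ℕ)) (ν : ℕ → ℕ) : Prop :=
  ∃ a b : ℕ, (∀ p ∈ cellsOf ν, p.1 ≤ a ∧ p.2 ≤ b) ∧
    γ = (fun p : ℕ × ℕ => (a - p.1, b - p.2)) '' cellsOf ν

/-- Iterated Littlewood–Richardson coefficients `c^l_{μ^1, …, μ^r}`:
`c^l_{μ} = δ_{l μ}`, and the coefficient for a longer list is obtained by
summing, over partitions `g` of the total size of the remaining factors, the
product of the iterated coefficient of `g` with `c^l_{g μ}`. -/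
noncomputable def iterLR : List (ℕ → ℕ) → (ℕ → ℕ) → ℕ
  | [], l => if l = (fun _ => 0 : ℕ → ℕ) then 1 else 0
  | [μ], l => if l = μ then 1 else 0
  | μ :: μs, l =>
      ∑' g : {g : ℕ → ℕ // IsPartition g ∧ psize g = (μs.map psize).sum},
        iterLR μs g.1 * LRcoeff l g.1 μ

/-- `D(q, m, B)`: partitions `λ` of `qm` with `c^λ_{μ_1, …, μ_q} > 0` for some
`μ_1, …, μ_q ∈ B` that are not all equal. -/
noncomputable def Dset (q m : ℕ) (B : Set (ℕ → ℕ)) : Set (ℕ → ℕ) :=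
  {l ∈ Pset (q * m) | ∃ μ : Fin q → (ℕ → ℕ),
    (∀ i, μ i ∈ B) ∧ (∃ i j, μ i ≠ μ j) ∧ 0 < iterLR (List.ofFn μ) l}

/-- Iterated `⋆` of a list of sets of partitions. -/
def starAll : List (Set (ℕ → ℕ)) → Set (ℕ → ℕ)
  | [] => Pset 0
  | [A] => A
  | A :: B :: rest => starOp A (starAll (B :: rest))

/-- `Ω(φ(1,0,…,0))` for the Sylow 3-subgroup of `S_{3^k}` (`k ≥ 4`):
`B_{3^k}(2a) ∖ {(2a, a−1, 1), (2a, 2, 1^{a−2}), (2a−1, a+1), (2a−1, 1^{a+1})}°`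
where `a = 3^{k−1}`. -/
noncomputable def Cset (k : ℕ) : Set (ℕ → ℕ) :=
  Bset (3 ^ k) (2 * 3 ^ (k - 1)) \
    conjClosure
      {ofList [2 * 3 ^ (k - 1), 3 ^ (k - 1) - 1, 1],
       ofList (2 * 3 ^ (k - 1) :: 2 :: List.replicate (3 ^ (k - 1) - 2) 1),
       ofList [2 * 3 ^ (k - 1) - 1, 3 ^ (k - 1) + 1],
       hookP (2 * 3 ^ (k - 1) - 1) (3 ^ (k - 1) + 1)}

/-! ### Conjugation and sizes of partitions -/

theorem lt_conj_iff {f : ℕ → ℕ} (hf : IsPartition f) (i j : ℕ) :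
    i < conj f j ↔ j < f i := by
  obtain ⟨hanti, N, hN⟩ := hf
  have hex : ∃ k, f k ≤ j := ⟨N, by simp [hN N le_rfl]⟩
  have hmem : ∀ i, i < Nat.find hex ↔ j < f i := by
    intro i
    rw [Nat.lt_find_iff]
    exact ⟨fun h => not_le.1 (h i le_rfl), fun h k hk => not_le.2 (h.trans_le (hanti hk))⟩
  have hset : {i | j < f i} = Set.Iio (Nat.find hex) := by
    ext i
    simp [hmem]
  have hcard : conj f j = Nat.find hex := by
    rw [conj, hset, ← Finset.coe_Iio, Set.ncard_coe_finset, Nat.card_Iio]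
  rw [hcard, hmem]

theorem conj_le_iff {f : ℕ → ℕ} (hf : IsPartition f) (i j : ℕ) :
    conj f j ≤ i ↔ f i ≤ j := by
  rw [← not_lt, lt_conj_iff hf, not_lt]

theorem IsPartition.conj {f : ℕ → ℕ} (hf : IsPartition f) : IsPartition (conj f) := by
  refine ⟨fun j j' h => ?_, f 0, fun j hj => ?_⟩
  · rw [conj_le_iff hf]
    exact ((conj_le_iff hf _ _).1 le_rfl).trans h
  · exact Nat.le_zero.1 ((conj_le_iff hf _ _).2 hj)

theorem conj_conj {f : ℕ → ℕ} (hf : IsPartition f) : conj (conj f) = f := by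
  funext i
  refine eq_of_forall_lt_iff fun j => ?_
  rw [lt_conj_iff hf.conj, lt_conj_iff hf]

theorem IsPartition.eq_zero_of_conj_le {f : ℕ → ℕ} (hf : IsPartition f) {i : ℕ}
    (hi : SylowBranching.conj f 0 ≤ i) : f i = 0 :=
  Nat.le_zero.1 ((conj_le_iff hf _ _).1 hi)

theorem cellsOf_eq_coe {f : ℕ → ℕ} {N : ℕ} (hN : ∀ i, N ≤ i → f i = 0) :
    cellsOf f = ((Finset.range N).sigma fun i => Finset.range (f i)).map
      (Equiv.sigmaEquivProd ℕ ℕ).toEmbedding := by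
  ext ⟨i, j⟩
  simp only [cellsOf, Set.mem_ofPred_eq, Finset.coe_map, Set.mem_image, Finset.mem_coe,
    Finset.mem_sigma, Finset.mem_range]
  constructor
  · intro h
    refine ⟨⟨i, j⟩, ⟨?_, h⟩, rfl⟩
    by_contra! hi
    simp [hN i hi] at h
  · rintro ⟨⟨i', j'⟩, ⟨-, h⟩, he⟩
    simp only [Equiv.coe_toEmbedding, Equiv.sigmaEquivProd_apply, Prod.mk.injEq] at he
    obtain ⟨rfl, rfl⟩ := he
    exact h

theorem psize_eq_sum {f : ℕ → ℕ} {N : ℕ} (hN : ∀ i, N ≤ i → f i = 0) :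
    psize f = ∑ i ∈ Finset.range N, f i := by
  rw [psize, cellsOf_eq_coe hN, Set.ncard_coe_finset, Finset.card_map, Finset.card_sigma]
  simp

theorem IsPartition.finite_cellsOf {f : ℕ → ℕ} (hf : IsPartition f) : (cellsOf f).Finite := by
  obtain ⟨-, N, hN⟩ := hf
  rw [cellsOf_eq_coe hN]
  exact Finset.finite_toSet _

theorem cellsOf_conj {f : ℕ → ℕ} (hf : IsPartition f) :
    cellsOf (conj f) = Prod.swap '' cellsOf f := by
  ext ⟨i, j⟩
  simp [cellsOf, lt_conj_iff hf]

theorem psize_conj {f : ℕ → ℕ} (hf : IsPartition f) : psize (conj f) = psize f := by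
  rw [psize, cellsOf_conj hf, Set.ncard_image_of_injective _ Prod.swap_injective, psize]

theorem skewCells_conj {l μ : ℕ → ℕ} (hl : IsPartition l) (hμ : IsPartition μ) :
    skewCells (conj l) (conj μ) = Prod.swap '' skewCells l μ := by
  ext ⟨i, j⟩
  simp [skewCells, lt_conj_iff hl, conj_le_iff hμ]

theorem conj_le_conj {l μ : ℕ → ℕ} (hl : IsPartition l) (hμ : IsPartition μ)
    (h : ∀ i, μ i ≤ l i) (j : ℕ) : conj μ j ≤ conj l j :=
  (conj_le_iff hμ _ _).2 ((h _).trans ((conj_le_iff hl _ _).1 le_rfl))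

theorem IsPartition.finite_skewCells {l : ℕ → ℕ} (hl : IsPartition l) (μ : ℕ → ℕ) :
    (skewCells l μ).Finite :=
  hl.finite_cellsOf.subset fun _ h => h.2

theorem psize_eq_add_ncard_skewCells {l μ : ℕ → ℕ} (hl : IsPartition l) (hμ : IsPartition μ)
    (h : ∀ i, μ i ≤ l i) : psize l = psize μ + (skewCells l μ).ncard := by
  have hunion : cellsOf l = cellsOf μ ∪ skewCells l μ := by
    ext ⟨i, j⟩
    have := h i
    simp only [cellsOf, skewCells, Set.mem_union, Set.mem_ofPred_eq]
    omega
  have hdisj : Disjoint (cellsOf μ) (skewCells l μ) := by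
    rw [Set.disjoint_left]
    rintro ⟨i, j⟩ h1 h2
    exact absurd h1 (not_lt.2 h2.1)
  rw [psize, hunion, Set.ncard_union_eq hdisj hμ.finite_cellsOf (hl.finite_skewCells μ), psize]

/-! ### Numerical estimates -/

theorem IsPartition.add_conj_le {f : ℕ → ℕ} (hf : IsPartition f) (h : 0 < f 0) :
    f 0 + SylowBranching.conj f 0 ≤ psize f + 1 := by
  have hb : 0 < SylowBranching.conj f 0 := (lt_conj_iff hf _ _).2 h
  rw [psize_eq_sum fun i => hf.eq_zero_of_conj_le (i := i)]
  obtain ⟨b, hb'⟩ := Nat.exists_eq_succ_of_ne_zero hb.ne'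
  have hpos : ∀ i ∈ Finset.range b, 1 ≤ f (i + 1) := fun i hi =>
    (lt_conj_iff hf _ _).1 (by rw [hb']; have := Finset.mem_range.1 hi; omega)
  have := Finset.sum_le_sum hpos
  rw [hb', Finset.sum_range_succ']
  simp at this
  omega

theorem IsPartition.psize_le {f : ℕ → ℕ} (hf : IsPartition f) :
    psize f ≤ f 0 + (SylowBranching.conj f 0 - 1) * f 1 := by
  obtain hb | hb := Nat.eq_zero_or_pos (SylowBranching.conj f 0)
  · rw [psize_eq_sum fun i => hf.eq_zero_of_conj_le (i := i), hb]
    simp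
  · rw [psize_eq_sum fun i => hf.eq_zero_of_conj_le (i := i)]
    obtain ⟨b, hb'⟩ := Nat.exists_eq_succ_of_ne_zero hb.ne'
    have hle : ∀ i ∈ Finset.range b, f (i + 1) ≤ f 1 := fun i _ => hf.1 (by omega)
    have := Finset.sum_le_sum hle
    rw [hb', Finset.sum_range_succ']
    simp at this ⊢
    omega

theorem IsPartition.add_mul_le {f : ℕ → ℕ} (hf : IsPartition f) (t : ℕ) :
    f 0 + t * f t ≤ psize f := by
  obtain ⟨hanti, N, hN⟩ := hf
  rw [psize_eq_sum (N := N + t + 1) fun i hi => hN i (by omega)]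
  have hsub : ∑ i ∈ Finset.range (t + 1), f i ≤ ∑ i ∈ Finset.range (N + t + 1), f i :=
    Finset.sum_le_sum_of_subset (Finset.range_mono (by omega))
  have hge : ∀ i ∈ Finset.range t, f t ≤ f (i + 1) := fun i hi =>
    hanti (Finset.mem_range.1 hi)
  have := Finset.sum_le_sum hge
  rw [Finset.sum_range_succ'] at hsub
  simp at this
  omega

theorem IsPartition.add_add_le {f : ℕ → ℕ} (hf : IsPartition f) :
    f 0 + f 1 + f 2 ≤ psize f := by
  obtain ⟨-, N, hN⟩ := hf
  rw [psize_eq_sum (N := N + 3) fun i hi => hN i (by omega)]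
  have hsub : ∑ i ∈ Finset.range 3, f i ≤ ∑ i ∈ Finset.range (N + 3), f i :=
    Finset.sum_le_sum_of_subset (Finset.range_mono (by omega))
  simpa [Finset.sum_range_succ] using hsub

/-! ### Pieri rules for three cells -/

theorem ofList_three (i : ℕ) : ofList [3] i = if i = 0 then 3 else 0 := by
  rcases i with _ | i <;> simp [ofList]

theorem ofList_one_one_one (i : ℕ) : ofList [1, 1, 1] i = if i < 3 then 1 else 0 := by
  rcases i with _ | _ | _ | i <;> simp [ofList]

theorem finite_setOf_LRFilling {γ : Set (ℕ × ℕ)} (hγ : γ.Finite) {ν : ℕ → ℕ} {N : ℕ}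
    (hν : ∀ j, N ≤ j → ν j = 0) :
    {T : ℕ × ℕ → ℕ | (∀ c, c ∉ γ → T c = 0) ∧ IsLRFilling γ ν T}.Finite := by
  have hbound : ∀ T, IsLRFilling γ ν T → ∀ c ∈ γ, T c < N + 1 := by
    intro T hT c hc
    by_contra! hlt
    have hw := hT.weight (T c) (hT.pos c hc)
    rw [hν _ (by omega), Set.ncard_eq_zero (hγ.subset fun _ h => h.1)] at hw
    exact hw.le (show c ∈ {d ∈ γ | T d = T c} from ⟨hc, rfl⟩)
  have := hγ.to_subtype
  refine Set.Finite.of_injOn (t := Set.univ)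
    (f := fun (T : ℕ × ℕ → ℕ) (c : γ) => (Fin.ofNat (N + 1) (T c) : Fin (N + 1)))
    (fun _ _ => Set.mem_univ _) ?_ Set.finite_univ
  rintro T ⟨hT0, hT⟩ S ⟨hS0, hS⟩ h
  funext c
  by_cases hc : c ∈ γ
  · have hval := congrArg Fin.val (congrFun h ⟨c, hc⟩)
    simpa [Fin.ofNat, Nat.mod_eq_of_lt (hbound T hT c hc),
      Nat.mod_eq_of_lt (hbound S hS c hc)] using hval
  · rw [hT0 c hc, hS0 c hc]

theorem LRcoeff_pos_iff {l μ ν : ℕ → ℕ} (hl : IsPartition l) {N : ℕ}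
    (hν : ∀ j, N ≤ j → ν j = 0) :
    0 < LRcoeff l μ ν ↔ (∀ i, μ i ≤ l i) ∧ ∃ T, IsLRFilling (skewCells l μ) ν T := by
  have hfin : {T : ℕ × ℕ → ℕ | (∀ i, μ i ≤ l i) ∧ (∀ c, c ∉ skewCells l μ → T c = 0) ∧
      IsLRFilling (skewCells l μ) ν T}.Finite :=
    (finite_setOf_LRFilling (hl.finite_skewCells μ) hν).subset fun _ h => h.2
  rw [LRcoeff, Set.ncard_pos hfin]
  constructor
  · rintro ⟨T, hle, -, hT⟩
    exact ⟨hle, T, hT⟩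
  · rintro ⟨hle, T, hT⟩
    set S : ℕ × ℕ → ℕ := fun c => if c ∈ skewCells l μ then T c else 0 with hS
    have hST : ∀ c ∈ skewCells l μ, S c = T c := fun c hc => if_pos hc
    have hset : ∀ P : ℕ → ℕ × ℕ → Prop,
        {c ∈ skewCells l μ | P (S c) c} = {c ∈ skewCells l μ | P (T c) c} := by
      intro P
      ext c
      exact and_congr_right fun hc => by rw [hST c hc]
    refine ⟨S, hle, fun c hc => if_neg hc, ⟨?_, ?_, ?_, ?_, ?_⟩⟩
    · intro c hc
      rw [hST c hc]
      exact hT.pos c hc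
    · intro j hj
      rw [hset fun x _ => x = j]
      exact hT.weight j hj
    · intro i j j' h h' hj
      rw [hST _ h, hST _ h']
      exact hT.row_weak i j j' h h' hj
    · intro i i' j h h' hi
      rw [hST _ h, hST _ h']
      exact hT.col_strict i i' j h h' hi
    · intro c hc j hj
      rw [hset fun x d => x = j + 1 ∧ readBefore d c, hset fun x d => x = j ∧ readBefore d c]
      exact hT.lattice c hc j hj

theorem exists_LRFilling_three_iff {γ : Set (ℕ × ℕ)} (hγ : γ.Finite) :
    (∃ T, IsLRFilling γ (ofList [3]) T) ↔ γ.ncard = 3 ∧ Set.InjOn Prod.snd γ := by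
  constructor
  · rintro ⟨T, hT⟩
    have hone : ∀ c ∈ γ, T c = 1 := by
      intro c hc
      by_contra hne
      have hpos := hT.pos c hc
      have hw := hT.weight (T c) hpos
      rw [ofList_three, if_neg (by omega), Set.ncard_eq_zero (hγ.subset fun _ h => h.1)] at hw
      exact hw.le (show c ∈ {d ∈ γ | T d = T c} from ⟨hc, rfl⟩)
    constructor
    · have hw := hT.weight 1 le_rfl
      rwa [Set.sep_eq_self_iff_mem_true.2 hone, ofList_three] at hw
    · rintro ⟨i, j⟩ hc ⟨i', j'⟩ hc' (rfl : j = j')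
      rcases lt_trichotomy i i' with h | rfl | h
      · have := hT.col_strict _ _ _ hc hc' h
        rw [hone _ hc, hone _ hc'] at this
        omega
      · rfl
      · have := hT.col_strict _ _ _ hc' hc h
        rw [hone _ hc, hone _ hc'] at this
        omega
  · rintro ⟨hcard, hinj⟩
    refine ⟨fun _ => 1, fun _ _ => le_rfl, ?_, fun _ _ _ _ _ _ => le_rfl, ?_, ?_⟩
    · intro j hj
      rw [ofList_three]
      by_cases h : j = 1
      · simp [h, hcard]
      · have h' : ¬ 1 = j := fun e => h e.symm
        simp [h', show j - 1 ≠ 0 by omega]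
    · intro i i' j h h' hlt
      have := congrArg Prod.fst (hinj h h' rfl)
      simp only at this
      omega
    · intro c _ j hj
      have he : {d ∈ γ | 1 = j + 1 ∧ readBefore d c} = ∅ :=
        Set.eq_empty_iff_forall_notMem.2 fun d hd => by have := hd.2.1; omega
      simp only [he, Set.ncard_empty, zero_le]

theorem IsLRFilling.exists_readBefore {γ : Set (ℕ × ℕ)} {ν : ℕ → ℕ} {T : ℕ × ℕ → ℕ}
    (hγ : γ.Finite) (hT : IsLRFilling γ ν T) {c : ℕ × ℕ} (hc : c ∈ γ) {k : ℕ} (hk : 1 ≤ k)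
    (hkc : k ≤ T c) : ∃ d ∈ γ, T d = k ∧ readBefore d c := by
  induction hkc using Nat.decreasingInduction with
  | self => exact ⟨c, hc, rfl, Or.inr ⟨rfl, le_rfl⟩⟩
  | of_succ k _ ih =>
    obtain ⟨d, hd⟩ := ih (by omega)
    have hpos : 0 < {d ∈ γ | T d = k + 1 ∧ readBefore d c}.ncard :=
      (Set.ncard_pos (hγ.subset fun _ h => h.1)).2 ⟨d, hd⟩
    obtain ⟨e, he⟩ := (Set.ncard_pos (hγ.subset fun _ h => h.1)).1
      (hpos.trans_le (hT.lattice c hc k hk))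
    exact ⟨e, he⟩

theorem ncard_eq_three_and_injOn_fst {γ : Set (ℕ × ℕ)} (hγ : γ.Finite) {T : ℕ × ℕ → ℕ}
    (hT : IsLRFilling γ (ofList [1, 1, 1]) T) : γ.ncard = 3 ∧ Set.InjOn Prod.fst γ := by
  have hle : ∀ c ∈ γ, T c ≤ 3 := by
    intro c hc
    by_contra! hlt
    have hw := hT.weight (T c) (hT.pos c hc)
    rw [ofList_one_one_one, if_neg (by omega), Set.ncard_eq_zero (hγ.subset fun _ h => h.1)] at hw
    exact hw.le (show c ∈ {d ∈ γ | T d = T c} from ⟨hc, rfl⟩)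
  have huniq : ∀ k, 1 ≤ k → k ≤ 3 → ∃ d, {c ∈ γ | T c = k} = {d} := by
    intro k hk hk'
    rw [← Set.ncard_eq_one, hT.weight k hk, ofList_one_one_one, if_pos (by omega)]
  have hinj : Set.InjOn T γ := by
    intro c hc d hd h
    obtain ⟨e, he⟩ := huniq (T c) (hT.pos c hc) (hle c hc)
    have h1 : c ∈ ({e} : Set (ℕ × ℕ)) := he ▸ ⟨hc, rfl⟩
    have h2 : d ∈ ({e} : Set (ℕ × ℕ)) := he ▸ ⟨hd, h.symm⟩
    exact h1.trans h2.symm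
  constructor
  · have himage : T '' γ = Finset.Icc 1 3 := by
      ext k
      simp only [Set.mem_image, Finset.coe_Icc, Set.mem_Icc]
      constructor
      · rintro ⟨c, hc, rfl⟩
        exact ⟨hT.pos c hc, hle c hc⟩
      · rintro ⟨h, h'⟩
        obtain ⟨d, hd⟩ := huniq k h h'
        exact ⟨d, hd.ge rfl⟩
    rw [← hinj.ncard_image, himage, Set.ncard_coe_finset, Nat.card_Icc]
  · have hrow : ∀ i j j', (i, j) ∈ γ → (i, j') ∈ γ → ¬ j < j' := by
      intro i j j' h h' hlt
      obtain ⟨d, hd, hTd, hread⟩ := hT.exists_readBefore hγ h' (hT.pos _ h)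
        (hT.row_weak i j j' h h' hlt.le)
      rw [hinj hd h hTd] at hread
      rcases hread with hread | ⟨-, hread⟩ <;> simp only at hread <;> omega
    rintro ⟨i, j⟩ h ⟨i', j'⟩ h' (rfl : i = i')
    have h1 := hrow _ _ _ h h'
    have h2 := hrow _ _ _ h' h
    rw [show j = j' by omega]

theorem exists_LRFilling_one_one_one_iff {γ : Set (ℕ × ℕ)} (hγ : γ.Finite) :
    (∃ T, IsLRFilling γ (ofList [1, 1, 1]) T) ↔ γ.ncard = 3 ∧ Set.InjOn Prod.fst γ := by
  refine ⟨fun ⟨T, hT⟩ => ncard_eq_three_and_injOn_fst hγ hT, ?_⟩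
  rintro ⟨hcard, hinj⟩
  have hrows : (hγ.toFinset.image Prod.fst).card = 3 := by
    rw [Finset.card_image_of_injOn (by simpa using hinj), ← hcard, Set.ncard_eq_toFinset_card γ hγ]
  set r := (hγ.toFinset.image Prod.fst).orderEmbOfFin hrows with hr
  have hr01 : r 0 < r 1 := r.strictMono (by decide)
  have hr12 : r 1 < r 2 := r.strictMono (by decide)
  have hcell : ∀ k, ∃ c ∈ γ, c.1 = r k := by
    intro k
    obtain ⟨c, hc, hck⟩ := Finset.mem_image.1 (Finset.orderEmbOfFin_mem _ hrows k)
    exact ⟨c, hγ.mem_toFinset.1 hc, hck⟩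
  have hex : ∀ c ∈ γ, c.1 = r 0 ∨ c.1 = r 1 ∨ c.1 = r 2 := by
    intro c hc
    have hmem : c.1 ∈ Set.range r := by
      rw [hr, Finset.range_orderEmbOfFin]
      simpa using ⟨_, hc⟩
    obtain ⟨k, hk⟩ := hmem
    fin_cases k
    · exact Or.inl hk.symm
    · exact Or.inr (Or.inl hk.symm)
    · exact Or.inr (Or.inr hk.symm)
  obtain ⟨c₀, hc₀, h₀⟩ := hcell 0
  obtain ⟨c₁, hc₁, h₁⟩ := hcell 1
  obtain ⟨c₂, hc₂, h₂⟩ := hcell 2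
  set T : ℕ × ℕ → ℕ := fun c => if c.1 = r 0 then 1 else if c.1 = r 1 then 2 else 3 with hTdef
  have hTval : ∀ c ∈ γ, (c.1 = r 0 ∧ T c = 1) ∨ (c.1 = r 1 ∧ T c = 2) ∨ (c.1 = r 2 ∧ T c = 3) := by
    intro c hc
    simp only [hTdef]
    rcases hex c hc with h | h | h
    · simp [h]
    · simp [h, hr01.ne']
    · simp [h, hr12.ne', (hr01.trans hr12).ne']
  have hmono : ∀ c ∈ γ, ∀ d ∈ γ, c.1 < d.1 → T c < T d := by
    intro c hc d hd h
    have := hTval c hc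
    have := hTval d hd
    omega
  have hsub : ∀ k, {c ∈ γ | T c = k}.Subsingleton := by
    rintro k c ⟨hc, hck⟩ d ⟨hd, hdk⟩
    apply hinj hc hd
    have := hTval c hc
    have := hTval d hd
    omega
  have hsurj : ∀ k, 1 ≤ k → k ≤ 3 → ∃ c ∈ γ, T c = k := by
    intro k hk hk'
    have h0 := hTval c₀ hc₀
    have h1 := hTval c₁ hc₁
    have h2 := hTval c₂ hc₂
    obtain h | h | h : k = 1 ∨ k = 2 ∨ k = 3 := by omega
    · exact ⟨c₀, hc₀, by omega⟩
    · exact ⟨c₁, hc₁, by omega⟩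
    · exact ⟨c₂, hc₂, by omega⟩
  refine ⟨T, ?_, ?_, ?_, fun i i' j h h' hlt => hmono _ h _ h' hlt, ?_⟩
  · intro c hc
    have := hTval c hc
    omega
  · intro j hj
    rw [ofList_one_one_one]
    split_ifs with h
    · obtain ⟨c, hc⟩ := hsurj j hj (by omega)
      rw [Set.ncard_eq_one]
      exact ⟨c, (hsub j).eq_singleton_of_mem hc⟩
    · rw [Set.ncard_eq_zero (hγ.subset fun _ h => h.1), Set.eq_empty_iff_forall_notMem]
      rintro c ⟨hc, hcj⟩
      have := hTval c hc
      omega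
  · intro i j j' h h' _
    rw [show j = j' from congrArg Prod.snd (hinj h h' rfl)]
  · intro c hc j hj
    rcases Set.eq_empty_or_nonempty {d ∈ γ | T d = j + 1 ∧ readBefore d c} with
      he | ⟨d, hd, hdj, hread⟩
    · simp [he]
    · have hle : {d ∈ γ | T d = j + 1 ∧ readBefore d c}.ncard ≤ 1 :=
        (Set.ncard_le_one (hγ.subset fun _ h => h.1)).2 fun a ha b hb =>
          hsub (j + 1) ⟨ha.1, ha.2.1⟩ ⟨hb.1, hb.2.1⟩
      refine hle.trans ((Set.ncard_pos (hγ.subset fun _ h => h.1)).2 ?_)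
      obtain ⟨e, he, hej⟩ := hsurj j hj (by have := hTval d hd; omega)
      refine ⟨e, he, hej, Or.inl ?_⟩
      have := hTval d hd
      have := hTval e he
      have : d.1 ≤ c.1 := by
        rcases hread with h | ⟨h, -⟩ <;> omega
      omega

theorem mem_starOp_iff {A : Set (ℕ → ℕ)} {l : ℕ → ℕ} :
    l ∈ starOp A {ofList [3], ofList [1, 1, 1]} ↔
      IsPartition l ∧ ∃ μ ∈ A, (∀ i, μ i ≤ l i) ∧ (skewCells l μ).ncard = 3 ∧
        (Set.InjOn Prod.snd (skewCells l μ) ∨ Set.InjOn Prod.fst (skewCells l μ)) := by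
  refine and_congr_right fun hl => exists_congr fun μ => and_congr_right fun _ => ?_
  have h3 : ∀ j, 3 ≤ j → ofList [3] j = 0 := fun j hj => by
    rw [ofList_three, if_neg (by omega)]
  have h111 : ∀ j, 3 ≤ j → ofList [1, 1, 1] j = 0 := fun j hj => by
    rw [ofList_one_one_one, if_neg (by omega)]
  simp only [Set.mem_insert_iff, Set.mem_singleton_iff, exists_eq_or_imp, exists_eq_left,
    LRcoeff_pos_iff hl h3, LRcoeff_pos_iff hl h111,
    exists_LRFilling_three_iff (hl.finite_skewCells μ),
    exists_LRFilling_one_one_one_iff (hl.finite_skewCells μ)]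
  tauto

/-! ### Removing strips -/

theorem exists_sum_eq_between {L U : ℕ → ℕ} (h : ∀ i, L i ≤ U i) (N m : ℕ)
    (hL : ∑ i ∈ Finset.range N, L i ≤ m) (hU : m ≤ ∑ i ∈ Finset.range N, U i) :
    ∃ f : ℕ → ℕ, (∀ i, L i ≤ f i) ∧ (∀ i, f i ≤ U i) ∧ ∑ i ∈ Finset.range N, f i = m := by
  induction N generalizing m with
  | zero => exact ⟨U, h, fun _ => le_rfl, by simp at hU ⊢; omega⟩
  | succ N ih =>
    rw [Finset.sum_range_succ] at hL hU
    have hLU : ∑ i ∈ Finset.range N, L i ≤ ∑ i ∈ Finset.range N, U i :=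
      Finset.sum_le_sum fun i _ => h i
    have hN := h N
    set x := max (L N) (m - ∑ i ∈ Finset.range N, U i) with hx
    obtain ⟨f, hfL, hfU, hf⟩ := ih (m - x) (by omega) (by omega)
    refine ⟨Function.update f N x, fun i => ?_, fun i => ?_, ?_⟩
    · rcases eq_or_ne i N with rfl | hi
      · rw [Function.update_self]
        omega
      · rw [Function.update_of_ne hi]
        exact hfL i
    · rcases eq_or_ne i N with rfl | hi
      · rw [Function.update_self]
        omega
      · rw [Function.update_of_ne hi]
        exact hfU i
    · rw [Finset.sum_range_succ, Function.update_self, Finset.sum_congr rfl (g := f), hf]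
      · omega
      · intro i hi
        exact Function.update_of_ne (Finset.mem_range.1 hi).ne _ _

/-- Numerical conditions under which a horizontal strip of three cells can be removed from `l`
so as to leave a partition contained in the `t × t` square. -/
def HasRemovableStrip (l : ℕ → ℕ) (t : ℕ) : Prop :=
  conj l 0 ≤ t + 1 ∧ l 1 ≤ t ∧ 3 ≤ l 0 ∧ l 0 - t + l t ≤ 3

theorem HasRemovableStrip.exists_partition {l : ℕ → ℕ} {m t : ℕ} (hl : IsPartition l)
    (ht : 0 < t) (hsize : psize l = m + 3) (h : HasRemovableStrip l t) :
    ∃ μ ∈ Bset m t, (∀ i, μ i ≤ l i) ∧ Set.InjOn Prod.snd (skewCells l μ) := by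
  obtain ⟨hlen, h1, h3, hforced⟩ := h
  have hzero : ∀ i, t + 1 ≤ i → l i = 0 := fun i hi => hl.eq_zero_of_conj_le (hlen.trans hi)
  have hsum := psize_eq_sum hzero
  have hsum' : psize l = ∑ i ∈ Finset.range (t + 1 + 1), l i :=
    psize_eq_sum fun i hi => hzero i (by omega)
  set U : ℕ → ℕ := fun i => if i = 0 then min (l 0) t else if i < t then l i else 0 with hUdef
  have hUl : ∀ i, U i ≤ l i := by
    intro i
    simp only [hUdef]
    split_ifs with h h'
    · rw [h]
      exact min_le_left _ _
    · exact le_rfl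
    · exact Nat.zero_le _
  have hLU : ∀ i, l (i + 1) ≤ U i := by
    intro i
    simp only [hUdef]
    split_ifs with h h'
    · rw [h]
      exact le_min (hl.1 (by omega)) h1
    · exact hl.1 (by omega)
    · exact (hzero _ (by omega)).le
  obtain ⟨μ, hμL, hμU, hμ⟩ := exists_sum_eq_between hLU (t + 1) m
    (by rw [Finset.sum_range_succ'] at hsum'; omega)
    (by
      obtain ⟨s, rfl⟩ := Nat.exists_eq_succ_of_ne_zero ht.ne'
      have hU : ∑ i ∈ Finset.range s, U (i + 1) = ∑ i ∈ Finset.range s, l (i + 1) :=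
        Finset.sum_congr rfl fun i hi => by
          simp [hUdef, Finset.mem_range.1 hi]
      have hU0 : U 0 = min (l 0) (s + 1) := by simp [hUdef]
      have hUs : U (s + 1) = 0 := by simp [hUdef]
      rw [Finset.sum_range_succ, Finset.sum_range_succ'] at hsum ⊢
      rw [hU, hU0, hUs]
      simp only [Nat.succ_eq_add_one] at *
      omega)
  have hμl : ∀ i, μ i ≤ l i := fun i => (hμU i).trans (hUl i)
  have hμzero : ∀ i, t ≤ i → μ i = 0 := by
    intro i hi
    have := hμU i
    simp only [hUdef, if_neg (show i ≠ 0 by omega), if_neg (show ¬ i < t by omega)] at this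
    omega
  have hμpart : IsPartition μ :=
    ⟨antitone_nat_of_succ_le fun i => (hμl _).trans (hμL i), t, hμzero⟩
  refine ⟨μ, ⟨⟨hμpart, ?_⟩, ?_, ?_⟩, hμl, ?_⟩
  · rw [psize_eq_sum (N := t + 1) fun i hi => hμzero i (by omega), hμ]
  · have := hμU 0
    simp only [hUdef, if_true] at this
    omega
  · rw [conj_le_iff hμpart, hμzero t le_rfl]
  · have hcol : ∀ i i' j, (i, j) ∈ skewCells l μ → (i', j) ∈ skewCells l μ → ¬ i < i' := by
      intro i i' j hc hc' hlt
      have hc1 : μ i ≤ j := hc.1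
      have hc2 : j < l i' := hc'.2
      have hc3 : l i' ≤ l (i + 1) := hl.1 hlt
      have := hμL i
      omega
    rintro ⟨i, j⟩ hc ⟨i', j'⟩ hc' (rfl : j = j')
    have := hcol _ _ _ hc hc'
    have := hcol _ _ _ hc' hc
    rw [show i = i' by omega]

theorem HasRemovableStrip.mem_starOp {l : ℕ → ℕ} {m t : ℕ} (hl : IsPartition l)
    (ht : 0 < t) (hsize : psize l = m + 3) (h : HasRemovableStrip l t) :
    l ∈ starOp (Bset m t) {ofList [3], ofList [1, 1, 1]} := by
  obtain ⟨μ, hμ, hle, hinj⟩ := h.exists_partition hl ht hsize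
  refine mem_starOp_iff.2 ⟨hl, μ, hμ, hle, ?_, Or.inl hinj⟩
  have := psize_eq_add_ncard_skewCells hl hμ.1.1 hle
  have := hμ.1.2
  omega

theorem conj_mem_Bset {f : ℕ → ℕ} {n t : ℕ} (hf : f ∈ Bset n t) : conj f ∈ Bset n t :=
  ⟨⟨hf.1.1.conj, (psize_conj hf.1.1).trans hf.1.2⟩, hf.2.2, by
    rw [conj_conj hf.1.1]
    exact hf.2.1⟩

theorem conj_mem_starOp {l : ℕ → ℕ} {m t : ℕ}
    (h : l ∈ starOp (Bset m t) {ofList [3], ofList [1, 1, 1]}) :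
    conj l ∈ starOp (Bset m t) {ofList [3], ofList [1, 1, 1]} := by
  obtain ⟨hl, μ, hμ, hle, hcard, hinj⟩ := mem_starOp_iff.1 h
  refine mem_starOp_iff.2 ⟨hl.conj, conj μ, conj_mem_Bset hμ, conj_le_conj hl hμ.1.1 hle, ?_⟩
  rw [skewCells_conj hl hμ.1.1, Set.ncard_image_of_injective _ Prod.swap_injective]
  refine ⟨hcard, hinj.symm.imp ?_ ?_⟩
  · rintro hinj _ ⟨c, hc, rfl⟩ _ ⟨d, hd, rfl⟩ hcd
    rw [hinj hc hd hcd]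
  · rintro hinj _ ⟨c, hc, rfl⟩ _ ⟨d, hd, rfl⟩ hcd
    rw [hinj hc hd hcd]

theorem eq_ofList_pair {l : ℕ → ℕ} {t : ℕ} (hl : IsPartition l) (h1 : t + 1 ≤ l 1)
    (hsize : psize l ≤ 2 * t + 2) : l = ofList [t + 1, t + 1] := by
  have h01 : l 1 ≤ l 0 := hl.1 (by omega)
  have h012 := hl.add_add_le
  funext i
  rcases i with _ | _ | i
  · simp only [ofList, List.getD_cons_zero]
    omega
  · simp only [ofList, List.getD_cons_succ, List.getD_cons_zero, zero_add]
    omega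
  · have h2 : l (i + 1 + 1) ≤ l 2 := hl.1 (by omega)
    simp only [ofList, List.getD_cons_succ, List.getD_nil]
    omega

theorem ofList_replicate_two (t i : ℕ) :
    ofList (List.replicate t 2) i = if i < t then 2 else 0 := by
  simp only [ofList, List.getD_eq_getElem?_getD, List.getElem?_replicate]
  split_ifs <;> rfl

theorem isPartition_ofList_replicate_two (t : ℕ) : IsPartition (ofList (List.replicate t 2)) := by
  refine ⟨fun i j hij => ?_, t, fun i hi => ?_⟩
  · rw [ofList_replicate_two, ofList_replicate_two]
    split_ifs <;> omega
  · rw [ofList_replicate_two, if_neg (by omega)]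

theorem conj_ofList_replicate_two (t : ℕ) :
    conj (ofList (List.replicate (t + 1) 2)) = ofList [t + 1, t + 1] := by
  funext j
  refine eq_of_forall_lt_iff fun i => ?_
  rw [lt_conj_iff (isPartition_ofList_replicate_two _), ofList_replicate_two]
  rcases j with _ | _ | j
  · simp only [ofList, List.getD_cons_zero]
    split_ifs <;> omega
  · simp only [ofList, List.getD_cons_succ, List.getD_cons_zero]
    split_ifs <;> omega
  · simp only [ofList, List.getD_cons_succ, List.getD_nil]
    split_ifs <;> omega

theorem psize_ofList_replicate_two (t : ℕ) :
    psize (ofList (List.replicate (t + 1) 2)) = 2 * t + 2 := by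
  rw [psize_eq_sum (N := t + 1) fun i hi => by rw [ofList_replicate_two, if_neg (by omega)],
    Finset.sum_congr rfl (g := fun _ => 2) fun i hi => by
      rw [ofList_replicate_two, if_pos (Finset.mem_range.1 hi)]]
  simp
  ring

theorem conj_ofList_pair (t : ℕ) :
    conj (ofList [t + 1, t + 1]) = ofList (List.replicate (t + 1) 2) := by
  rw [← conj_ofList_replicate_two, conj_conj (isPartition_ofList_replicate_two _)]

theorem psize_ofList_pair (t : ℕ) : psize (ofList [t + 1, t + 1]) = 2 * t + 2 := by
  rw [← conj_ofList_replicate_two, psize_conj (isPartition_ofList_replicate_two _),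
    psize_ofList_replicate_two]

theorem hasRemovableStrip_of_conj_le {l : ℕ → ℕ} {t : ℕ} (hl : IsPartition l)
    (hlow : t + 3 ≤ psize l) (hupp : psize l ≤ 2 * t + 2) (hrow : l 0 ≤ t + 3)
    (hcol : conj l 0 ≤ t) :
    HasRemovableStrip l t ∨ HasRemovableStrip (conj l) t ∨ l = ofList [t + 1, t + 1] := by
  by_cases h1 : t + 1 ≤ l 1
  · exact Or.inr (Or.inr (eq_ofList_pair hl h1 hupp))
  have hlt : l t = 0 := hl.eq_zero_of_conj_le hcol
  by_cases h3 : 3 ≤ l 0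
  · exact Or.inl ⟨by omega, by omega, h3, by omega⟩
  have h10 : l 1 ≤ l 0 := hl.1 (by omega)
  have hle := hl.psize_le
  have hmul : (conj l 0 - 1) * l 1 ≤ (conj l 0 - 1) * 2 := Nat.mul_le_mul_left _ (by omega)
  have hanti : conj l 1 ≤ conj l 0 := hl.conj.1 (by omega)
  have hconjt : conj l t = 0 := Nat.le_zero.1 ((conj_le_iff hl _ _).2 (by omega))
  refine Or.inr (Or.inl ⟨?_, by omega, by omega, by omega⟩)
  rw [conj_conj hl]
  omega

theorem hasRemovableStrip_of_lt {l : ℕ → ℕ} {t : ℕ} (hl : IsPartition l) (ht : 0 < t)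
    (hlow : t + 3 ≤ psize l) (hupp : psize l ≤ 2 * t + 2)
    (hcol : t + 1 ≤ conj l 0) (hle : conj l 0 ≤ l 0) :
    HasRemovableStrip l t ∨ l = ofList [t + 1, t + 1] := by
  by_cases h1 : t + 1 ≤ l 1
  · exact Or.inr (eq_ofList_pair hl h1 hupp)
  have hhook := hl.add_conj_le (by omega)
  have hsize := hl.psize_le
  have hlast : l t ≤ 1 := by
    by_contra! h
    have hmul := hl.add_mul_le t
    have : t * 2 ≤ t * l t := Nat.mul_le_mul_left _ h
    rcases Nat.lt_or_ge t 2 with h2 | h2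
    · obtain rfl : t = 1 := by omega
      omega
    · omega
  refine Or.inl ⟨by omega, by omega, ?_, by omega⟩
  by_contra! h3
  obtain rfl : t = 1 := by omega
  have hb : conj l 0 = 2 := by omega
  rw [hb] at hsize
  omega

theorem mem_starOp_or_eq {l : ℕ → ℕ} {m t : ℕ} (ht : 0 < t) (h1 : m < 2 * t) (h2 : t ≤ m)
    (hl : l ∈ Bset (m + 3) (t + 3)) :
    l ∈ starOp (Bset m t) {ofList [3], ofList [1, 1, 1]} ∨
      l = ofList [t + 1, t + 1] ∨ l = ofList (List.replicate (t + 1) 2) := by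
  obtain ⟨⟨hpart, hsize⟩, hrow, hcol⟩ := hl
  have hsize' := (psize_conj hpart).trans hsize
  have hcc := conj_conj hpart
  have key : HasRemovableStrip l t ∨ HasRemovableStrip (conj l) t ∨
      l = ofList [t + 1, t + 1] ∨ conj l = ofList [t + 1, t + 1] := by
    by_cases hb : conj l 0 ≤ t
    · have := hasRemovableStrip_of_conj_le hpart (t := t) (by omega) (by omega) hrow hb
      tauto
    by_cases ha : l 0 ≤ t
    · have := hasRemovableStrip_of_conj_le hpart.conj (t := t) (by omega) (by omega) hcol
        (by rwa [hcc])
      rw [hcc] at this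
      tauto
    rcases le_total (conj l 0) (l 0) with h | h
    · have := hasRemovableStrip_of_lt hpart ht (by omega) (by omega) (by omega) h
      tauto
    · have := hasRemovableStrip_of_lt hpart.conj ht (by omega) (by omega)
        (by rw [hcc]; omega) (by rwa [hcc])
      tauto
  rcases key with h | h | h | h
  · exact Or.inl (h.mem_starOp hpart ht hsize)
  · have := conj_mem_starOp (h.mem_starOp hpart.conj ht hsize')
    rw [hcc] at this
    exact Or.inl this
  · exact Or.inr (Or.inl h)
  · rw [← hcc, h, conj_ofList_pair]
    exact Or.inr (Or.inr rfl)

/-! ### Upper bound for the product -/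

theorem apply_zero_le_add_ncard_skewCells {l μ : ℕ → ℕ} (hl : IsPartition l) :
    l 0 ≤ μ 0 + (skewCells l μ).ncard := by
  have hsub : ((Finset.Ico (μ 0) (l 0)).image fun j => ((0, j) : ℕ × ℕ) : Set (ℕ × ℕ)) ⊆
      skewCells l μ := by
    intro c hc
    simp only [Finset.coe_image, Finset.coe_Ico, Set.mem_image, Set.mem_Ico] at hc
    obtain ⟨j, hj, rfl⟩ := hc
    exact hj
  have hcard := Set.ncard_le_ncard hsub (hl.finite_skewCells μ)
  rw [Set.ncard_coe_finset, Finset.card_image_of_injective _ (Prod.mk_right_injective 0),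
    Nat.card_Ico] at hcard
  omega

theorem starOp_subset_Bset (m t : ℕ) :
    starOp (Bset m t) {ofList [3], ofList [1, 1, 1]} ⊆ Bset (m + 3) (t + 3) := by
  intro l h
  have hrow : ∀ {l}, l ∈ starOp (Bset m t) {ofList [3], ofList [1, 1, 1]} → l 0 ≤ t + 3 := by
    intro l h
    obtain ⟨hl, μ, hμ, hle, hcard, -⟩ := mem_starOp_iff.1 h
    have := apply_zero_le_add_ncard_skewCells (μ := μ) hl
    have := hμ.2.1
    omega
  have hcol := hrow (conj_mem_starOp h)
  obtain ⟨hl, μ, hμ, hle, hcard, -⟩ := mem_starOp_iff.1 h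
  refine ⟨⟨hl, ?_⟩, hrow h, hcol⟩
  rw [psize_eq_add_ncard_skewCells hl hμ.1.1 hle, hcard, hμ.1.2]

theorem ofList_pair_notMem_starOp (m t : ℕ) :
    ofList [t + 1, t + 1] ∉ starOp (Bset m t) {ofList [3], ofList [1, 1, 1]} := by
  intro h
  obtain ⟨hl, μ, hμ, hle, hcard, hinj⟩ := mem_starOp_iff.1 h
  have hμ0 : μ 0 ≤ t := hμ.2.1
  have hμ1 : μ 1 ≤ μ 0 := hμ.1.1.1 (by omega)
  rcases hinj with hinj | hinj
  · have h0 : (0, t) ∈ skewCells (ofList [t + 1, t + 1]) μ := ⟨hμ0, by simp [ofList]⟩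
    have h1 : (1, t) ∈ skewCells (ofList [t + 1, t + 1]) μ := ⟨hμ1.trans hμ0, by simp [ofList]⟩
    simpa using hinj h0 h1 rfl
  · have hmaps : ∀ c ∈ skewCells (ofList [t + 1, t + 1]) μ, c.1 ∈ (Finset.range 2 : Set ℕ) := by
      rintro ⟨i, j⟩ ⟨-, hc⟩
      rcases i with _ | _ | i
      · simp
      · simp
      · simp [ofList] at hc
    have := Set.ncard_le_ncard_of_injOn _ hmaps hinj (Finset.finite_toSet _)
    rw [Set.ncard_coe_finset, Finset.card_range] at this
    omega

theorem ofList_replicate_two_notMem_starOp (m t : ℕ) :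
    ofList (List.replicate (t + 1) 2) ∉
      starOp (Bset m t) {ofList [3], ofList [1, 1, 1]} := by
  intro h
  have := conj_mem_starOp h
  rw [conj_ofList_replicate_two] at this
  exact ofList_pair_notMem_starOp m t this

theorem starOp_Bset_of_ne {m t : ℕ} (ht : 0 < t) (h1 : m < 2 * t) (h2 : t ≤ m)
    (hne : m ≠ 2 * t - 1) :
    starOp (Bset m t) {ofList [3], ofList [1, 1, 1]} = Bset (m + 3) (t + 3) := by
  refine (starOp_subset_Bset m t).antisymm fun l hl => ?_
  have hsize := hl.1.2
  rcases mem_starOp_or_eq ht h1 h2 hl with h | rfl | rfl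
  · exact h
  · rw [psize_ofList_pair] at hsize
    omega
  · rw [psize_ofList_replicate_two] at hsize
    omega

theorem Bset_eq_Pset {n t : ℕ} (h : n ≤ t) : Bset n t = Pset n := by
  refine Set.Subset.antisymm (fun f hf => hf.1) fun f hf => ⟨hf, ?_, ?_⟩
  · have := hf.1.add_add_le
    have := hf.2
    omega
  · have := hf.1.conj.add_add_le
    have := psize_conj hf.1
    have := hf.2
    omega

/-- for positive `m, t` with `m/2 < t ≤ m`,
`B_m(t) ⋆ {(3), (1,1,1)}` equals `B_{m+3}(t+3)` minus `{(t+1,t+1), (2^{t+1})}`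
if `m = 2t − 1`, and equals `B_{m+3}(t+3)` otherwise; in particular
`P(m) ⋆ {(3), (1,1,1)} = P(m+3)` for every `m ≥ 2`. -/
theorem star_three_cube (m t : ℕ) (hm : 0 < m) (ht : 0 < t)
    (h1 : m < 2 * t) (h2 : t ≤ m) :
    (m = 2 * t - 1 →
      starOp (Bset m t) {ofList [3], ofList [1, 1, 1]} =
        Bset (m + 3) (t + 3) \
          {ofList [t + 1, t + 1], ofList (List.replicate (t + 1) 2)}) ∧
    (m ≠ 2 * t - 1 →
      starOp (Bset m t) {ofList [3], ofList [1, 1, 1]} = Bset (m + 3) (t + 3)) ∧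
    (∀ m' : ℕ, 2 ≤ m' →
      starOp (Pset m') {ofList [3], ofList [1, 1, 1]} = Pset (m' + 3)) := by
  refine ⟨fun hm' => ?_, starOp_Bset_of_ne ht h1 h2, fun m' hm' => ?_⟩
  · refine Set.Subset.antisymm (fun l hl => ⟨starOp_subset_Bset m t hl, ?_⟩) fun l hl => ?_
    · rintro (rfl | rfl)
      · exact ofList_pair_notMem_starOp m t hl
      · exact ofList_replicate_two_notMem_starOp m t hl
    · exact (mem_starOp_or_eq ht h1 h2 hl.1).resolve_right hl.2
  · have := starOp_Bset_of_ne (m := m') (t := m') (by omega) (by omega) le_rfl (by omega)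
    rwa [Bset_eq_Pset le_rfl, Bset_eq_Pset le_rfl] at this

end SylowBranching
end

section
/- Let γ be a skew shape and let s ≥ 3 and t ≥ 1 be integers with (s, 1^t) ∈ LR(γ). Then either (s−1, 2, 1^{t−1}) ∈ LR(γ), or in every LR filling of γ of weight (s, 1^t) at least s−1 of the entries equal to 1 occur in a single row of γ. -/
open scoped Classical

namespace SylowBranching

theorem skewCells_finite {l m : ℕ → ℕ} (hl : IsPartition l) : (skewCells l m).Finite := by
  obtain ⟨hanti, N, hN⟩ := hl
  refine ((Set.finite_Iio N).prod (Set.finite_Iio (l 0))).subset ?_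
  rintro ⟨i, j⟩ ⟨-, hj⟩
  simp only at hj
  refine ⟨?_, lt_of_lt_of_le hj (hanti (Nat.zero_le i))⟩
  by_contra hi
  have := hN i (not_lt.mp hi)
  omega

theorem hookP_zero (s t : ℕ) : hookP s t 0 = s := by simp [hookP, ofList]

theorem hookP_one {s t : ℕ} (ht : 1 ≤ t) : hookP s t 1 = 1 := by
  obtain ⟨t, rfl⟩ := Nat.exists_eq_add_of_le' ht
  simp [hookP, ofList, List.replicate_succ]

theorem ofList_add_two_eq_hookP {s t : ℕ} (ht : 1 ≤ t) (k : ℕ) :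
    ofList ((s - 1) :: 2 :: List.replicate (t - 1) 1) (k + 2) = hookP s t (k + 2) := by
  obtain ⟨t, rfl⟩ := Nat.exists_eq_add_of_le' ht
  simp [hookP, ofList, List.replicate_succ]

/-- Every row containing an entry `1` has a rightmost such entry. -/
theorem exists_rightmost_one {γ : Set (ℕ × ℕ)} (hγ : γ.Finite) {T : ℕ × ℕ → ℕ} {b : ℕ × ℕ}
    (hb : b ∈ γ) (hTb : T b = 1) :
    ∃ c ∈ γ, T c = 1 ∧ c.1 = b.1 ∧ ∀ j, (c.1, j) ∈ γ → T (c.1, j) = 1 → j ≤ c.2 := by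
  have hfin : {d ∈ γ | T d = 1 ∧ d.1 = b.1}.Finite := hγ.subset fun _ h => h.1
  obtain ⟨c, ⟨hc, hTc, hcb⟩, hmax⟩ := hfin.exists_maximalFor Prod.snd _ ⟨b, hb, hTb, rfl⟩
  refine ⟨c, hc, hTc, hcb, fun j hj hTj => ?_⟩
  have := @hmax (c.1, j) ⟨hj, hTj, hcb⟩
  simp only at this
  omega

/-- Changing a suitable entry `1` of an LR filling of hook weight into a `2`. -/
theorem IsLRFilling.update_one_two {γ : Set (ℕ × ℕ)} (hγ : γ.Finite) {s t : ℕ} (ht : 1 ≤ t)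
    {T : ℕ × ℕ → ℕ} (hT : IsLRFilling γ (hookP s t) T) {c e : ℕ × ℕ}
    (hc : c ∈ γ) (hTc : T c = 1)
    (hright : ∀ j, (c.1, j) ∈ γ → T (c.1, j) = 1 → j ≤ c.2)
    (he : {d ∈ γ | T d = 2} = {e})
    (hbelow : c.1 < e.1 → c.2 ≠ e.2)
    (habove : ∃ a ∈ γ, T a = 1 ∧ a.1 < c.1)
    (hthree : ∀ x ∈ γ, readBefore e x → readBefore c x →
      3 ≤ Set.ncard {d ∈ γ | T d = 1 ∧ readBefore d x}) :
    IsLRFilling γ (ofList ((s - 1) :: 2 :: List.replicate (t - 1) 1))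
      (Function.update T c 2) := by
  have hfin : ∀ p : ℕ × ℕ → Prop, {d ∈ γ | p d}.Finite := fun p => hγ.subset fun _ h => h.1
  have hmem : ∀ d, d ∈ γ → T d = 2 → d = e := fun d hd h2 => by
    have : d ∈ {d ∈ γ | T d = 2} := ⟨hd, h2⟩
    rwa [he] at this
  have hother : ∀ d k, k ≠ 1 → k ≠ 2 → (Function.update T c 2 d = k ↔ T d = k) := by
    intro d k h1 h2
    by_cases hd : d = c
    · subst hd; simp [hTc]; omega
    · simp [hd]
  have hone : ∀ d, Function.update T c 2 d = 1 ↔ T d = 1 ∧ d ≠ c := by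
    intro d
    by_cases hd : d = c
    · subst hd; simp
    · simp [hd]
  have htwo : ∀ d, Function.update T c 2 d = 2 ↔ T d = 2 ∨ d = c := by
    intro d
    by_cases hd : d = c
    · subst hd; simp
    · simp [hd]
  refine ⟨?_, ?_, ?_, ?_, ?_⟩
  · intro d hd
    by_cases hdc : d = c
    · simp [hdc]
    · simpa [hdc] using hT.pos d hd
  · intro j hj
    obtain rfl | rfl | ⟨k, rfl⟩ : j = 1 ∨ j = 2 ∨ ∃ k, j = k + 3 := by
      rcases Nat.lt_or_ge j 3 with h | h
      · omega
      · exact Or.inr (Or.inr ⟨j - 3, by omega⟩)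
    · have hw := hT.weight 1 le_rfl
      have hset : {d ∈ γ | Function.update T c 2 d = 1} = {d ∈ γ | T d = 1} \ {c} := by
        ext d; simp [hone]; tauto
      have hcmem : c ∈ {d ∈ γ | T d = 1} := ⟨hc, hTc⟩
      rw [hset, Set.ncard_sdiff_singleton_of_mem hcmem, hw, hookP_zero]
      simp [ofList]
    · have hset : {d ∈ γ | Function.update T c 2 d = 2} = {c, e} := by
        ext d
        have hd2 : d ∈ γ ∧ T d = 2 ↔ d = e := by
          simpa using Set.ext_iff.mp he d
        simp only [htwo, Set.mem_ofPred_eq, Set.mem_insert_iff, Set.mem_singleton_iff, ← hd2]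
        constructor
        · tauto
        · rintro (rfl | h)
          · exact ⟨hc, Or.inr rfl⟩
          · tauto
      have hne : c ≠ e := by
        rintro rfl
        have : c ∈ {d ∈ γ | T d = 2} := by rw [he]; rfl
        have := this.2
        omega
      rw [hset, Set.ncard_pair hne]
      simp [ofList]
    · have hset : {d ∈ γ | Function.update T c 2 d = k + 3} = {d ∈ γ | T d = k + 3} := by
        ext d; simp [hother d (k + 3) (by omega) (by omega)]
      rw [hset, hT.weight _ hj]
      exact (ofList_add_two_eq_hookP ht k).symm
  · intro i j j' h h' hjj
    have hrow := hT.row_weak i j j' h h' hjj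
    have hpos := hT.pos _ h'
    by_cases h1 : (i, j) = c
    · by_cases h2 : (i, j') = c
      · rw [h1, h2]
      · subst h1
        have hr := hright j' h'
        have hlt : j ≠ j' := by rintro rfl; exact h2 rfl
        simp only [Function.update_self, Function.update_of_ne h2]
        simp only at hr
        omega
    · by_cases h2 : (i, j') = c
      · rw [h2, hTc] at hrow
        rw [h2, Function.update_self, Function.update_of_ne h1]
        omega
      · simpa [h1, h2] using hrow
  · intro i i' j h h' hii
    have hcol := hT.col_strict i i' j h h' hii
    have hpos := hT.pos _ h
    by_cases h1 : (i, j) = c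
    · have h2 : (i', j) ≠ c := by
        rintro rfl
        simp at h1
        omega
      have hne : T (i', j) ≠ 2 := by
        intro heq
        have := hmem _ h' heq
        subst h1 this
        exact hbelow hii rfl
      rw [h1, Function.update_self, Function.update_of_ne h2]
      rw [h1, hTc] at hcol
      omega
    · by_cases h2 : (i', j) = c
      · rw [h2, hTc] at hcol
        omega
      · simpa [h1, h2] using hcol
  · intro x hx j hj
    have hlat := hT.lattice x hx j hj
    obtain rfl | rfl | hj3 : j = 1 ∨ j = 2 ∨ 3 ≤ j := by omega
    · simp only [hone, htwo]
      by_cases hcx : readBefore c x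
      · have hO : {d ∈ γ | (T d = 1 ∧ d ≠ c) ∧ readBefore d x} =
            {d ∈ γ | T d = 1 ∧ readBefore d x} \ {c} := by
          ext d; simp; tauto
        have hcmem : c ∈ {d ∈ γ | T d = 1 ∧ readBefore d x} := ⟨hc, hTc, hcx⟩
        rw [hO, Set.ncard_sdiff_singleton_of_mem hcmem]
        by_cases hex : readBefore e x
        · have h3 := hthree x hx hex hcx
          have hsub : {d ∈ γ | (T d = 2 ∨ d = c) ∧ readBefore d x} ⊆ {c, e} := by
            rintro d ⟨hd, h2 | h2, -⟩
            · exact Or.inr (hmem d hd h2)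
            · exact Or.inl h2
          have := Set.ncard_le_ncard hsub
          have := Set.ncard_insert_le c {e}
          rw [Set.ncard_singleton] at this
          omega
        · obtain ⟨a, ha, hTa, hac⟩ := habove
          have hax : readBefore a x := by
            simp only [readBefore] at hcx ⊢
            omega
          have hsub : {d ∈ γ | (T d = 2 ∨ d = c) ∧ readBefore d x} ⊆ {c} := by
            rintro d ⟨hd, h2 | h2, hdx⟩
            · exact absurd (hmem d hd h2 ▸ hdx) hex
            · exact h2
          have hpair : ({a, c} : Set (ℕ × ℕ)) ⊆ {d ∈ γ | T d = 1 ∧ readBefore d x} := by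
            rintro d (rfl | rfl)
            · exact ⟨ha, hTa, hax⟩
            · exact ⟨hc, hTc, hcx⟩
          have h1 := Set.ncard_le_ncard hsub
          have h2 := Set.ncard_le_ncard hpair (hfin _)
          rw [Set.ncard_pair (by rintro rfl; omega)] at h2
          rw [Set.ncard_singleton] at h1
          omega
      · have hO : {d ∈ γ | (T d = 1 ∧ d ≠ c) ∧ readBefore d x} =
            {d ∈ γ | T d = 1 ∧ readBefore d x} := by
          ext d
          have : readBefore d x → d ≠ c := by rintro h rfl; exact hcx h
          simp; tauto
        have hW : {d ∈ γ | (T d = 1 + 1 ∨ d = c) ∧ readBefore d x} =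
            {d ∈ γ | T d = 1 + 1 ∧ readBefore d x} := by
          ext d
          have : readBefore d x → d ≠ c := by rintro h rfl; exact hcx h
          simp; tauto
        rwa [hO, hW]
    · simp only [htwo, hother _ (2 + 1) (by omega) (by omega)]
      refine hlat.trans (Set.ncard_le_ncard ?_ (hfin _))
      rintro d ⟨hd, h2, hdx⟩
      exact ⟨hd, Or.inl h2, hdx⟩
    · simpa only [hother _ (j + 1) (by omega) (by omega),
        hother _ j (by omega) (by omega)] using hlat

/-- if `γ = l/m` is a skew shape and `(s, 1^t) ∈ LR(γ)` with
`s ≥ 3`, `t ≥ 1`, then either `(s−1, 2, 1^{t−1}) ∈ LR(γ)`, or in every LR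
filling of `γ` of weight `(s, 1^t)` at least `s−1` of the entries equal to `1`
occur in a single row. -/
theorem lr_hook_filling (s t : ℕ) (hs : 3 ≤ s) (ht : 1 ≤ t)
    (l m : ℕ → ℕ) (hl : IsPartition l) (hm : IsPartition m) (hml : ∀ i, m i ≤ l i)
    (h : hookP s t ∈ LRset (skewCells l m)) :
    ofList ((s - 1) :: 2 :: List.replicate (t - 1) 1) ∈ LRset (skewCells l m) ∨
      ∀ T, IsLRFilling (skewCells l m) (hookP s t) T →
        ∃ r, s - 1 ≤ Set.ncard {c ∈ skewCells l m | T c = 1 ∧ c.1 = r} := by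
  rw [or_iff_not_imp_right]
  intro hno
  push Not at hno
  obtain ⟨T, hT, hrow⟩ := hno
  have hγ : (skewCells l m).Finite := skewCells_finite hl
  have hfin : ∀ p : ℕ × ℕ → Prop, {d ∈ skewCells l m | p d}.Finite :=
    fun p => hγ.subset fun _ h => h.1
  have hcard : Set.ncard {d ∈ skewCells l m | T d = 1} = s := by
    rw [hT.weight 1 le_rfl, hookP_zero]
  obtain ⟨e, he⟩ : ∃ e, {d ∈ skewCells l m | T d = 2} = {e} := by
    rw [← Set.ncard_eq_one, hT.weight 2 (by omega), hookP_one ht]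
  have hmem : e ∈ skewCells l m ∧ T e = 2 := by
    have : e ∈ {d ∈ skewCells l m | T d = 2} := by rw [he]; rfl
    exact this
  have huniq : ∀ d ∈ skewCells l m, T d = 2 → d = e := fun d hd h2 => by
    have : d ∈ {d ∈ skewCells l m | T d = 2} := ⟨hd, h2⟩
    rwa [he] at this
  obtain ⟨b, ⟨hb, hTb⟩, hbmax⟩ := (hfin fun d => T d = 1).exists_maximalFor Prod.fst _
    (Set.nonempty_of_ncard_ne_zero (by omega))
  obtain ⟨c, hc, hTc, hcb, hright⟩ := exists_rightmost_one hγ hb hTb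
  have hlast : ∀ d ∈ skewCells l m, T d = 1 → d.1 ≤ c.1 := by
    intro d hd hTd
    have := @hbmax d ⟨hd, hTd⟩
    omega
  -- The entries `1` strictly above the row of `c`.
  have hsplit : Set.ncard {d ∈ skewCells l m | T d = 1 ∧ d.1 < c.1} +
      Set.ncard {d ∈ skewCells l m | T d = 1 ∧ d.1 = c.1} = s := by
    rw [← hcard, ← Set.ncard_union_eq _ (hfin _) (hfin _)]
    · congr 1
      ext d
      have := hlast d
      simp only [Set.mem_union, Set.mem_ofPred_eq]
      constructor
      · tauto
      · rintro ⟨hd, h1⟩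
        rcases (this hd h1).lt_or_eq with h | h <;> tauto
    · rw [Set.disjoint_left]
      rintro d ⟨-, -, h1⟩ ⟨-, -, h2⟩
      omega
  have hup : 2 ≤ Set.ncard {d ∈ skewCells l m | T d = 1 ∧ d.1 < c.1} := by
    have := hrow c.1
    omega
  obtain ⟨a, ha, hTa, hac⟩ : {d ∈ skewCells l m | T d = 1 ∧ d.1 < c.1}.Nonempty :=
    Set.nonempty_of_ncard_ne_zero (by omega)
  rcases le_or_gt e.1 c.1 with hec | hce
  · refine ⟨_, hT.update_one_two hγ ht hc hTc hright he (by omega) ⟨a, ha, hTa, hac⟩ ?_⟩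
    intro x hx _ hcx
    have hsub : insert c {d ∈ skewCells l m | T d = 1 ∧ d.1 < c.1} ⊆
        {d ∈ skewCells l m | T d = 1 ∧ readBefore d x} := by
      rintro d (rfl | ⟨hd, hTd, hdc⟩)
      · exact ⟨hc, hTc, hcx⟩
      · refine ⟨hd, hTd, ?_⟩
        simp only [readBefore] at hcx ⊢
        omega
    have h1 := Set.ncard_le_ncard hsub (hfin _)
    rw [Set.ncard_insert_of_notMem (fun h => lt_irrefl _ h.2.2) (hfin _)] at h1
    omega
  · have hthree : ∀ x ∈ skewCells l m, readBefore e x →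
        3 ≤ Set.ncard {d ∈ skewCells l m | T d = 1 ∧ readBefore d x} := by
      intro x hx hex
      have hsub : {d ∈ skewCells l m | T d = 1} ⊆
          {d ∈ skewCells l m | T d = 1 ∧ readBefore d x} := by
        rintro d ⟨hd, hTd⟩
        have := hlast d hd hTd
        refine ⟨hd, hTd, ?_⟩
        simp only [readBefore] at hex ⊢
        omega
      have h1 := Set.ncard_le_ncard hsub (hfin _)
      omega
    by_cases hcol : c.2 = e.2
    · -- `c` is the only `1` in its row, so some row strictly between contains a `1`.
      have hsingle : {d ∈ skewCells l m | T d = 1 ∧ d.1 = c.1} ⊆ {c} := by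
        rintro ⟨i, j⟩ ⟨hd, hTd, hi⟩
        simp only at hi
        subst hi
        have hjc := hright j hd hTd
        by_contra hne
        have hj : j ≠ c.2 := by rintro rfl; exact hne rfl
        have hmanti := hm.1 hce.le
        have hd' : (e.1, j) ∈ skewCells l m := by
          have h1 := hd.1
          have h2 := hmem.1.2
          simp only [skewCells, Set.mem_ofPred_eq] at h1 h2 ⊢
          omega
        have h1 := hT.col_strict _ _ _ hd hd' hce
        have h2 := hT.row_weak e.1 j e.2 hd' hmem.1 (by omega)
        rw [Prod.mk.eta, hmem.2] at h2
        have h3 := congrArg Prod.snd (huniq _ hd' (by omega))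
        simp only at h3
        omega
      have hle := Set.ncard_le_ncard hsingle
      rw [Set.ncard_singleton] at hle
      have hnot : ¬ {d ∈ skewCells l m | T d = 1 ∧ d.1 < c.1} ⊆
          {d ∈ skewCells l m | T d = 1 ∧ d.1 = a.1} := by
        intro hsub
        have h1 := Set.ncard_le_ncard hsub (hfin _)
        have h2 := hrow a.1
        omega
      obtain ⟨a', ⟨ha', hTa', hac'⟩, hne⟩ := Set.not_subset.mp hnot
      have haa : a'.1 ≠ a.1 := fun h => hne ⟨ha', hTa', h⟩
      obtain ⟨p, q, hp, hTp, hq, hTq, hpq, hqc⟩ : ∃ p q, p ∈ skewCells l m ∧ T p = 1 ∧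
          q ∈ skewCells l m ∧ T q = 1 ∧ p.1 < q.1 ∧ q.1 < c.1 := by
        rcases haa.lt_or_gt with h | h
        · exact ⟨a', a, ha', hTa', ha, hTa, h, hac⟩
        · exact ⟨a, a', ha, hTa, ha', hTa', h, hac'⟩
      obtain ⟨f, hf, hTf, hfq, hfright⟩ := exists_rightmost_one hγ hq hTq
      refine ⟨_, hT.update_one_two hγ ht hf hTf hfright he ?_ ⟨p, hp, hTp, by omega⟩
        fun x hx hex _ => hthree x hx hex⟩
      intro _ hfe
      have hf' : (f.1, c.2) = f := Prod.ext rfl (by simp only; omega)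
      have := hT.col_strict f.1 c.1 c.2 (by rwa [hf']) hc (by omega)
      rw [hf', Prod.mk.eta] at this
      omega
    · exact ⟨_, hT.update_one_two hγ ht hc hTc hright he (fun _ => hcol) ⟨a, ha, hTa, hac⟩
        fun x hx hex _ => hthree x hx hex⟩

end SylowBranching
end
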